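/- Existence of Mikado flows: for every compact subset 𝒩 ⊂⊂ 𝒮^{3×3}_+ of the positive-definite symmetric 3×3 matrices there exists a smooth vector field W : 𝒩 × 𝕋³ → ℝ³ such that for every R ∈ 𝒩: (i) div_ξ(W(R,ξ) ⊗ W(R,ξ)) = 0 and div_ξ W(R,ξ) = 0; (ii) the average ∫_{𝕋³} W(R,ξ) dξ (normalized by the volume of 𝕋³) equals 0; and (iii) the normalized average ∫_{𝕋³} W(R,ξ) ⊗ W(R,ξ) dξ equals R. -/

import Mathlib

open MeasureTheory Real Filter Set

noncomputable section

namespace FNS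

/-! ## Basic setting: the torus `𝕋³ = ℝ³/ℤ³` realized as `ℤ³`-periodic functions on `ℝ³`. -/

/-- Points of space `ℝ³`. -/
abbrev Sp : Type := Fin 3 → ℝ
/-- Values of vector fields. -/
abbrev V3 : Type := Fin 3 → ℝ
/-- 3×3 real matrices (as nested functions). -/
abbrev Mat3 : Type := Fin 3 → Fin 3 → ℝ

/-- The fundamental domain of `𝕋³ = ℝ³/ℤ³` (of unit volume). -/
def unitCube : Set Sp := {x | ∀ i, x i ∈ Set.Ico (0 : ℝ) 1}

/-- `ℤ³`-periodicity: a function defined on the torus. -/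
def Per {E : Type*} (f : Sp → E) : Prop :=
  ∀ (x : Sp) (k : Fin 3 → ℤ), f (x + fun i => (k i : ℝ)) = f x

def dotIZ (k : Fin 3 → ℤ) (x : Sp) : ℝ := ∑ i, (k i : ℝ) * x i

/-- The character `e^{2πi k·x}` of the torus. -/
def eK (k : Fin 3 → ℤ) (x : Sp) : ℂ := Complex.exp (2 * π * Complex.I * dotIZ k x)

/-- The `k`-th Fourier coefficient of a periodic function. -/
def fCoeff (f : Sp → ℝ) (k : Fin 3 → ℤ) : ℂ :=
  ∫ x in unitCube, (f x : ℂ) * eK (-k) x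

/-- Euclidean length of a frequency `k ∈ ℤ³`. -/
def knorm (k : Fin 3 → ℤ) : ℝ := Real.sqrt (∑ i, ((k i : ℝ)) ^ 2)

/-- A Fourier multiplier operator on periodic functions. -/
def fourierMult (m : (Fin 3 → ℤ) → ℂ) (f : Sp → ℝ) (x : Sp) : ℝ :=
  (∑' k : Fin 3 → ℤ, m k * fCoeff f k * eK k x).re

/-- The fractional Laplacian `(-Δ)^γ`: the `k`-th Fourier coefficient is multiplied
by `|k|^{2γ}`. -/
def fracLap (γ : ℝ) (f : Sp → ℝ) : Sp → ℝ :=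
  fourierMult (fun k => ((knorm k ^ (2 * γ) : ℝ) : ℂ)) f

/-- The fractional Laplacian acting componentwise on vector fields. -/
def fracLapV (γ : ℝ) (u : Sp → V3) (x : Sp) (i : Fin 3) : ℝ :=
  fracLap γ (fun y => u y i) x

/-- `(-Δ)^{-1}` as a Fourier multiplier (killing the mean). -/
def invLap (f : Sp → ℝ) : Sp → ℝ :=
  fourierMult (fun k => if k = 0 then 0 else (((knorm k ^ 2)⁻¹ : ℝ) : ℂ)) f

/-- Spatial partial derivative `∂_j`. -/
def pd (j : Fin 3) (f : Sp → ℝ) (x : Sp) : ℝ := fderiv ℝ f x (Pi.single j 1)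

/-- Spatial divergence of a vector field. -/
def sdiv (u : Sp → V3) (x : Sp) : ℝ := ∑ j, pd j (fun y => u y j) x

/-- Spatial gradient matrix `(∇Φ)_{ij} = ∂_j Φ^i`. -/
def gradM (Φ : Sp → Sp) (x : Sp) : Mat3 := fun i j => pd j (fun y => Φ y i) x

/-- curl of a vector field. -/
def curlV (u : Sp → V3) (x : Sp) : V3 :=
  fun j => pd (j + 1) (fun y => u y (j + 2)) x - pd (j + 2) (fun y => u y (j + 1)) x

/-- The Biot–Savart operator `ℬ u = (-Δ)^{-1} curl u`. -/
def biot (u : Sp → V3) (x : Sp) (j : Fin 3) : ℝ := invLap (fun y => curlV u y j) x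

/-- Material derivative `(∂_t + w·∇)u` of a vector field. -/
def matder (w u : ℝ → Sp → V3) (t : ℝ) (x : Sp) (j : Fin 3) : ℝ :=
  deriv (fun s => u s x j) t + ∑ m, w t x m * pd m (fun y => u t y j) x

/-- Material derivative `(∂_t + w·∇)u` of a scalar. -/
def matderS (w : ℝ → Sp → V3) (u : ℝ → Sp → ℝ) (t : ℝ) (x : Sp) : ℝ :=
  deriv (fun s => u s x) t + ∑ m, w t x m * pd m (u t) x

/-- Material derivative `(∂_t + w·∇)R` of a matrix field, entrywise. -/
def matderM (w : ℝ → Sp → V3) (R : ℝ → Sp → Mat3) (t : ℝ) (x : Sp) : Mat3 :=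
  fun i j => deriv (fun s => R s x i j) t + ∑ m, w t x m * pd m (fun y => R t y i j) x

/-! ## Hölder norms (spatial, and with supremum in time) -/

/-- Supremum norm `‖f‖₀`. -/
def C0 {E : Type*} [NormedAddCommGroup E] (f : Sp → E) : ℝ := ⨆ x, ‖f x‖

/-- Seminorm `[f]_N = sup ‖D^N f‖`. -/
def semN {E : Type*} [NormedAddCommGroup E] [NormedSpace ℝ E] (N : ℕ) (f : Sp → E) : ℝ :=
  ⨆ x, ‖iteratedFDeriv ℝ N f x‖

/-- Hölder seminorm `[f]_{N+α}`. -/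
def semH {E : Type*} [NormedAddCommGroup E] [NormedSpace ℝ E] (N : ℕ) (α : ℝ) (f : Sp → E) : ℝ :=
  ⨆ p : {p : Sp × Sp // p.1 ≠ p.2},
    ‖iteratedFDeriv ℝ N f p.val.1 - iteratedFDeriv ℝ N f p.val.2‖ / ‖p.val.1 - p.val.2‖ ^ α

/-- Norm `‖f‖_N = Σ_{j≤N} [f]_j`. -/
def cNorm {E : Type*} [NormedAddCommGroup E] [NormedSpace ℝ E] (N : ℕ) (f : Sp → E) : ℝ :=
  ∑ j ∈ Finset.range (N + 1), semN j f

/-- Hölder norm `‖f‖_{N+α}`. -/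
def hNorm {E : Type*} [NormedAddCommGroup E] [NormedSpace ℝ E] (N : ℕ) (α : ℝ) (f : Sp → E) : ℝ :=
  cNorm N f + semH N α f

/-- Low Hölder norm `‖f‖_α = ‖f‖₀ + [f]_α`, `0 ≤ α ≤ 1`. -/
def nrmH {E : Type*} [NormedAddCommGroup E] [NormedSpace ℝ E] (α : ℝ) (f : Sp → E) : ℝ :=
  C0 f + semH 0 α f

def C0T {E : Type*} [NormedAddCommGroup E] (u : ℝ → Sp → E) (s T : ℝ) : ℝ :=
  ⨆ t ∈ Set.Icc s T, C0 (u t)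

def semNT {E : Type*} [NormedAddCommGroup E] [NormedSpace ℝ E] (N : ℕ) (u : ℝ → Sp → E)
    (s T : ℝ) : ℝ := ⨆ t ∈ Set.Icc s T, semN N (u t)

def semHT {E : Type*} [NormedAddCommGroup E] [NormedSpace ℝ E] (N : ℕ) (α : ℝ)
    (u : ℝ → Sp → E) (s T : ℝ) : ℝ := ⨆ t ∈ Set.Icc s T, semH N α (u t)

def cNormT {E : Type*} [NormedAddCommGroup E] [NormedSpace ℝ E] (N : ℕ) (u : ℝ → Sp → E)
    (s T : ℝ) : ℝ := ⨆ t ∈ Set.Icc s T, cNorm N (u t)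

def hNormT {E : Type*} [NormedAddCommGroup E] [NormedSpace ℝ E] (N : ℕ) (α : ℝ)
    (u : ℝ → Sp → E) (s T : ℝ) : ℝ := ⨆ t ∈ Set.Icc s T, hNorm N α (u t)

/-- The `C¹` norm `‖u‖₁ = ‖u‖₀ + [u]₁` in space, with supremum in time. -/
def c1T (u : ℝ → Sp → V3) (s T : ℝ) : ℝ := C0T u s T + semNT 1 u s T

/-! ## Smoothness and PDE predicates -/

/-- Jointly smooth in time and space. -/
def SmoothST {E : Type*} [NormedAddCommGroup E] [NormedSpace ℝ E] (u : ℝ → Sp → E) : Prop :=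
  ContDiff ℝ (⊤ : ℕ∞) (fun p : ℝ × Sp => u p.1 p.2)

/-- Periodic in space at each time. -/
def PerT {E : Type*} (u : ℝ → Sp → E) : Prop := ∀ t, Per (u t)

/-- Row divergence of a matrix field: `(div R)^j = ∑_m ∂_m R^{jm}`. -/
def divRow (R : Sp → Mat3) (x : Sp) (j : Fin 3) : ℝ := ∑ m, pd m (fun y => R y j m) x

/-- The fractional Navier–Stokes–Reynolds system, pointwise on a time interval. -/
def SolvesNSR (ν γ : ℝ) (v : ℝ → Sp → V3) (p : ℝ → Sp → ℝ) (R : ℝ → Sp → Mat3)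
    (I : Set ℝ) : Prop :=
  ∀ t ∈ I, ∀ x : Sp,
    (∀ j, matder v v t x j + pd j (p t) x + ν * fracLapV γ (v t) x j = divRow (R t) x j) ∧
    sdiv (v t) x = 0

/-- The fractional Navier–Stokes equations, pointwise on a time interval. -/
def SolvesNS (ν γ : ℝ) (v : ℝ → Sp → V3) (p : ℝ → Sp → ℝ) (I : Set ℝ) : Prop :=
  ∀ t ∈ I, ∀ x : Sp,
    (∀ j, matder v v t x j + pd j (p t) x + ν * fracLapV γ (v t) x j = 0) ∧
    sdiv (v t) x = 0

/-- Symmetric and trace-free matrix field. -/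
def SymTF (R : ℝ → Sp → Mat3) : Prop :=
  ∀ t x, (∀ i j, R t x i j = R t x j i) ∧ (∑ i, R t x i i) = 0

/-! ## Weak (Leray–Hopf) solutions -/

/-- Weakly divergence-free (against smooth periodic test functions). -/
def WeakDivFreeAt (u : Sp → V3) : Prop :=
  ∀ ψ : Sp → ℝ, ContDiff ℝ (⊤ : ℕ∞) ψ → Per ψ → ∫ x in unitCube, ∑ i, u x i * pd i ψ x = 0

/-- Smooth divergence-free test vector fields, periodic in space,
compactly supported in time. -/
def TestVF (φ : ℝ → Sp → V3) : Prop :=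
  SmoothST φ ∧ PerT φ ∧
  (∃ Ta Tb : ℝ, ∀ t, t < Ta ∨ Tb < t → φ t = 0) ∧
  (∀ t x, sdiv (φ t) x = 0)

/-- Kinetic energy `∫_{𝕋³} |v|²(x,t) dx`. -/
def kinEnergy (v : ℝ → Sp → V3) (t : ℝ) : ℝ := ∫ x in unitCube, ∑ i, (v t x i) ^ 2

/-- Instantaneous dissipation `∫_{𝕋³} |(-Δ)^{γ/2} v|²(x,t) dx`. -/
def dissEnergy (γ : ℝ) (v : ℝ → Sp → V3) (t : ℝ) : ℝ :=
  ∫ x in unitCube, ∑ i, (fracLapV (γ / 2) (v t) x i) ^ 2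

/-- Leray–Hopf weak solution of `∂_t v + div(v⊗v) + ∇p + ν(-Δ)^γ v = 0`, `div v = 0`,
`v(·,0) = v0`, on `ℝ⁺ × 𝕋³`:  `v ∈ L^∞(ℝ⁺,L²) ∩ L²(ℝ⁺,H^γ)`, the equation holds
distributionally against divergence-free test fields, and the global energy inequality
holds. -/
def IsLerayHopf (γ ν : ℝ) (v0 : Sp → V3) (v : ℝ → Sp → V3) : Prop :=
  PerT v ∧
  (∃ C, ∀ t, 0 ≤ t → kinEnergy v t ≤ C) ∧
  IntegrableOn (fun t => dissEnergy γ v t) (Set.Ioi 0) ∧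
  (∀ t, 0 ≤ t → WeakDivFreeAt (v t)) ∧
  (∀ φ, TestVF φ →
    (∫ t in Set.Ioi (0 : ℝ), ∫ x in unitCube,
      ((∑ i, v t x i * deriv (fun s => φ s x i) t)
        - ν * (∑ i, v t x i * fracLapV γ (φ t) x i)
        + ∑ i, ∑ j, v t x i * v t x j * pd j (fun y => φ t y i) x))
      = - ∫ x in unitCube, ∑ i, v0 x i * φ 0 x i) ∧
  (∀ s t : ℝ, 0 ≤ s → s < t →
    (1 / 2) * kinEnergy v t + ν * ∫ τ in Set.Ioc s t, dissEnergy γ v τ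
      ≤ (1 / 2) * kinEnergy v s)

/-- `C^β` Hölder continuity in space. -/
def HolderSp (β : ℝ) (f : Sp → V3) : Prop :=
  ∃ C, ∀ x y : Sp, ‖f x - f y‖ ≤ C * ‖x - y‖ ^ β

/-- `C^β` Hölder continuity in space-time on `𝕋³ × [0,T]`. -/
def HolderST (β T : ℝ) (v : ℝ → Sp → V3) : Prop :=
  ∃ C, ∀ t ∈ Set.Icc (0 : ℝ) T, ∀ t' ∈ Set.Icc (0 : ℝ) T, ∀ x y : Sp,
    ‖v t x - v t' y‖ ≤ C * (|t - t'| + ‖x - y‖) ^ β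

/-! ## Convex integration parameters -/

/-- Frequency `λ_q = 2π⌈a^{b^q}⌉`. -/
def lam (a b : ℝ) (q : ℕ) : ℝ := 2 * π * (⌈a ^ (b ^ q)⌉₊ : ℝ)

/-- Amplitude `δ_q = λ_q^{-2β}`. -/
def del (a b βv : ℝ) (q : ℕ) : ℝ := lam a b q ^ (-(2 * βv))

/-- Mollification scale `ℓ`. -/
def ellQ (a b βv α : ℝ) (q : ℕ) : ℝ :=
  del a b βv (q + 1) ^ ((1 : ℝ) / 2) * del a b βv q ^ (-(1 : ℝ) / 2)
    * lam a b q ^ (-(1 + 3 * α / 2))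

/-- Gluing time scale `τ_q = ℓ^{2α}/(δ_q^{1/2}λ_q)`. -/
def tauQ (a b βv α : ℝ) (q : ℕ) : ℝ :=
  ellQ a b βv α q ^ (2 * α) / (del a b βv q ^ ((1 : ℝ) / 2) * lam a b q)

/-- Mollification `f ∗ ψ_ℓ` with `ψ_ℓ(y) = ℓ^{-3}ψ(y/ℓ)`. -/
def mollify {E : Type*} [NormedAddCommGroup E] [NormedSpace ℝ E] (ψ : Sp → ℝ) (ℓ : ℝ)
    (f : Sp → E) (x : Sp) : E :=
  ∫ y : Sp, (ℓ ^ (-3 : ℤ) * ψ (ℓ⁻¹ • y)) • f (x - y)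

/-- A standard mollification kernel. -/
def StdKernel (ψ : Sp → ℝ) : Prop :=
  ContDiff ℝ (⊤ : ℕ∞) ψ ∧ (∀ x, 0 ≤ ψ x) ∧ (∀ x : Sp, 1 < ‖x‖ → ψ x = 0) ∧ (∫ x : Sp, ψ x) = 1

/-- Traceless tensor product `u ⊗̊ w`. -/
def otimesT (u w : V3) : Mat3 :=
  fun i j => u i * w j - if i = j then (∑ m, u m * w m) / 3 else 0

/-- The inverse-divergence operator `ℛ` of De Lellis–Székelyhidi:
`ℛ^{ijk} = -½Δ^{-2}∂_i∂_j∂_k - ½Δ^{-1}∂_kδ_{ij} + Δ^{-1}∂_iδ_{jk} + Δ^{-1}∂_jδ_{ik}`. -/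
def Rop (f : Sp → V3) (x : Sp) : Mat3 := fun i j =>
  (-(1 : ℝ) / 2) * pd i (fun y => pd j (fun z =>
      ∑ m, pd m (invLap (invLap (fun w => f w m))) z) y) x
  + (1 / 2) * (if i = j then ∑ m, pd m (invLap (fun w => f w m)) x else 0)
  - pd i (invLap (fun w => f w j)) x - pd j (invLap (fun w => f w i)) x

/-- The inductive hypotheses of the convex integration scheme at level `q`. -/
def IndHyp (a b βv α ν γ M T : ℝ) (e : ℝ → ℝ) (q : ℕ)
    (v : ℝ → Sp → V3) (p : ℝ → Sp → ℝ) (R : ℝ → Sp → Mat3) : Prop :=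
  SmoothST v ∧ SmoothST p ∧ SmoothST R ∧ PerT v ∧ PerT p ∧ PerT R ∧
  SolvesNSR ν γ v p R (Set.Icc 0 T) ∧ SymTF R ∧
  (∀ t, (∫ x in unitCube, p t x) = 0) ∧
  C0T R 0 T ≤ del a b βv (q + 1) * lam a b q ^ (-(3 * α)) ∧
  c1T v 0 T ≤ M * del a b βv q ^ ((1 : ℝ) / 2) * lam a b q ∧
  C0T v 0 T ≤ 1 - del a b βv q ^ ((1 : ℝ) / 2) ∧
  (∀ t ∈ Set.Icc (0 : ℝ) T,
    del a b βv (q + 1) * lam a b q ^ (-α) ≤ e t - kinEnergy v t ∧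
    e t - kinEnergy v t ≤ del a b βv (q + 1))

end FNS
namespace FNS

/-- Symmetric positive-definite 3×3 matrix. -/
def SymPosDef (R : Mat3) : Prop :=
  (∀ i j, R i j = R j i) ∧ ∀ y : V3, y ≠ 0 → 0 < ∑ i, ∑ j, y i * R i j * y j

/-! ### Pipes: periodic smooth functions invariant along prescribed integer directions -/

lemma exists_ne_zero_orthogonal (u v : Fin 3 → ℤ) :
    ∃ n : Fin 3 → ℤ, n ≠ 0 ∧ ∑ i, n i * u i = 0 ∧ ∑ i, n i * v i = 0 := by
  have hdet : (Matrix.of ![u, v, 0]).det = 0 := Matrix.det_eq_zero_of_row_eq_zero 2 (by simp)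
  obtain ⟨n, hn, h⟩ := Matrix.exists_mulVec_eq_zero_iff.2 hdet
  have h0 := congrFun h 0
  have h1 := congrFun h 1
  simp only [Matrix.mulVec, dotProduct, Matrix.of_apply, Matrix.cons_val_zero,
    Matrix.cons_val_one, Pi.zero_apply] at h0 h1
  exact ⟨n, hn, by simpa only [mul_comm] using h0, by simpa only [mul_comm] using h1⟩

lemma exists_irrational_dotIZ : ∃ q : Sp, ∀ n : Fin 3 → ℤ, n ≠ 0 → Irrational (dotIZ n q) := by
  set t : ℝ := liouvilleNumber (2 : ℕ) with ht
  have htr : Transcendental ℤ t := transcendental_liouvilleNumber le_rfl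
  refine ⟨![t, t ^ 2, t ^ 3], fun n hn => ?_⟩
  rintro ⟨r, hr⟩
  rw [transcendental_iff] at htr
  have hden : (r.den : ℤ) ≠ 0 := by exact_mod_cast r.den_nz
  set p : Polynomial ℤ := Polynomial.C (r.den * n 0) * Polynomial.X
    + Polynomial.C (r.den * n 1) * Polynomial.X ^ 2
    + Polynomial.C (r.den * n 2) * Polynomial.X ^ 3 - Polynomial.C r.num with hp
  have hrt : (r : ℝ) * r.den = r.num := by exact_mod_cast Rat.mul_den_eq_num r
  have hp0 : p = 0 := by
    apply htr
    simp only [dotIZ, Fin.sum_univ_three, Matrix.cons_val_zero, Matrix.cons_val_one,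
      Matrix.cons_val] at hr
    simp only [hp, map_sub, map_add, map_mul, map_pow, Polynomial.aeval_X, Polynomial.aeval_C,
      algebraMap_int_eq, Int.coe_castRingHom, Int.cast_natCast]
    rw [← hrt, hr]
    ring
  apply hn
  have hc : ∀ m, p.coeff m = 0 := by simp [hp0]
  have h1 := hc 1
  have h2 := hc 2
  have h3 := hc 3
  simp only [hp, Polynomial.coeff_add, Polynomial.coeff_sub, Polynomial.coeff_C_mul,
    Polynomial.coeff_X_pow, Polynomial.coeff_X, Polynomial.coeff_C] at h1 h2 h3
  ext i
  fin_cases i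
  · simpa [hden] using h1
  · simpa [hden] using h2
  · simpa [hden] using h3

lemma dotIZ_sub (n : Fin 3 → ℤ) (x y : Sp) : dotIZ n (x - y) = dotIZ n x - dotIZ n y := by
  simp [dotIZ, mul_sub, Finset.sum_sub_distrib]

lemma dotIZ_add (n : Fin 3 → ℤ) (x y : Sp) : dotIZ n (x + y) = dotIZ n x + dotIZ n y := by
  simp [dotIZ, mul_add, Finset.sum_add_distrib]

lemma dotIZ_smul (n : Fin 3 → ℤ) (s : ℝ) (x : Sp) : dotIZ n (s • x) = s * dotIZ n x := by
  simp only [dotIZ, Pi.smul_apply, smul_eq_mul, Finset.mul_sum]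
  exact Finset.sum_congr rfl fun i _ => by ring

lemma dotIZ_intCast (n k : Fin 3 → ℤ) :
    dotIZ n (fun i => (k i : ℝ)) = ((∑ i, n i * k i : ℤ) : ℝ) := by
  simp [dotIZ]

lemma contDiff_dotIZ (n : Fin 3 → ℤ) {m : WithTop ℕ∞} : ContDiff ℝ m (dotIZ n) := by
  unfold dotIZ
  fun_prop

/-- The plane wave `cos (2π n·(x-p)) - cos (2π n·(x-q))`, which is positive at `p` and
negative at `q` unless `n·(p-q)` is an integer. -/
def wave (n : Fin 3 → ℤ) (p q : Sp) (x : Sp) : ℝ :=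
  cos (2 * π * dotIZ n (x - p)) - cos (2 * π * dotIZ n (x - q))

lemma wave_swap (n : Fin 3 → ℤ) (p q x : Sp) : wave n q p x = -wave n p q x := by
  simp [wave]

lemma contDiff_wave (n : Fin 3 → ℤ) (p q : Sp) {m : WithTop ℕ∞} : ContDiff ℝ m (wave n p q) := by
  unfold wave
  have h : ∀ p : Sp, ContDiff ℝ m fun x : Sp => dotIZ n (x - p) := fun p =>
    (contDiff_dotIZ n).comp (contDiff_id.sub contDiff_const)
  exact (Real.contDiff_cos.comp (contDiff_const.mul (h p))).sub
    (Real.contDiff_cos.comp (contDiff_const.mul (h q)))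

lemma wave_add (n : Fin 3 → ℤ) (p q x v : Sp) (j : ℤ) (hv : dotIZ n v = j) :
    wave n p q (x + v) = wave n p q x := by
  have h : ∀ p : Sp, cos (2 * π * dotIZ n (x + v - p)) = cos (2 * π * dotIZ n (x - p)) := by
    intro p
    rw [dotIZ_sub, dotIZ_add, dotIZ_sub, hv,
      ← Real.cos_add_int_mul_two_pi (2 * π * (dotIZ n x - dotIZ n p)) j]
    congr 1
    ring
  simp only [wave, h]

lemma wave_pos {n : Fin 3 → ℤ} {p q : Sp} (h : Irrational (dotIZ n (p - q))) :
    0 < wave n p q p := by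
  have h1 : cos (2 * π * dotIZ n (p - q)) ≠ 1 := by
    rw [Ne, Real.cos_eq_one_iff]
    rintro ⟨m, hm⟩
    refine h ⟨m, ?_⟩
    have : (2 * π) * (m : ℝ) = 2 * π * dotIZ n (p - q) := by linarith
    simpa using mul_left_cancel₀ (by positivity) this
  have h0 : dotIZ n (0 : Sp) = 0 := by simp [dotIZ]
  have := lt_of_le_of_ne (Real.cos_le_one _) h1
  simp only [wave, sub_self, h0, mul_zero, Real.cos_zero]
  linarith

lemma exists_pipes {ι : Type*} [Fintype ι] (f : ι → Fin 3 → ℤ) :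
    ∃ ψ : ι → Sp → ℝ, (∀ k, ContDiff ℝ (⊤ : ℕ∞) (ψ k)) ∧ (∀ k, Per (ψ k)) ∧
      (∀ k x (s : ℝ), ψ k (x + s • fun i => (f k i : ℝ)) = ψ k x) ∧
      (∀ k l, k ≠ l → ∀ x, ψ k x * ψ l x = 0) ∧
      (∀ k x, 0 ≤ ψ k x) ∧ ∀ k, ∃ x, 0 < ψ k x := by
  classical
  have hn : ∀ z : Sym2 ι, ∃ n : Fin 3 → ℤ, n ≠ 0 ∧ ∀ k ∈ z, ∑ i, n i * f k i = 0 := by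
    intro z
    induction z using Sym2.ind with
    | _ k l =>
      obtain ⟨n, hn, hk, hl⟩ := exists_ne_zero_orthogonal (f k) (f l)
      refine ⟨n, hn, fun j hj => ?_⟩
      rcases Sym2.mem_iff.1 hj with rfl | rfl <;> assumption
  choose n hn0 hn using hn
  obtain ⟨q, hq⟩ := exists_irrational_dotIZ
  set e := Fintype.equivFin ι
  set p : ι → Sp := fun k => ((e k : ℕ) : ℝ) • q with hp
  have hirr : ∀ k l, k ≠ l → ∀ m : Fin 3 → ℤ, m ≠ 0 → Irrational (dotIZ m (p k - p l)) := by
    intro k l hkl m hm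
    have hne : ((e k : ℕ) : ℤ) - (e l : ℕ) ≠ 0 := by
      rw [sub_ne_zero]
      exact_mod_cast fun h => hkl (e.injective (Fin.ext h))
    have : dotIZ m (p k - p l) = (((e k : ℕ) : ℤ) - (e l : ℕ) : ℤ) * dotIZ m q := by
      rw [dotIZ_sub, hp]
      simp only [dotIZ_smul]
      push_cast
      ring
    rw [this]
    exact (hq m hm).intCast_mul hne
  refine ⟨fun k x => ∏ l ∈ Finset.univ.erase k, expNegInvGlue (wave (n s(k, l)) (p k) (p l) x),
    fun k => ?_, fun k x v => ?_, fun k x s => ?_, fun k l hkl x => ?_, fun k x => ?_,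
    fun k => ⟨p k, ?_⟩⟩
  · exact contDiff_prod fun l _ => expNegInvGlue.contDiff.comp (contDiff_wave _ _ _)
  · refine Finset.prod_congr rfl fun l _ => ?_
    rw [wave_add _ _ _ _ _ _ (dotIZ_intCast _ _)]
  · refine Finset.prod_congr rfl fun l _ => ?_
    rw [wave_add _ _ _ _ _ 0]
    rw [dotIZ_smul, dotIZ_intCast, hn _ _ (Sym2.mem_mk_left k l)]
    simp
  · beta_reduce
    rcases le_total (wave (n s(k, l)) (p k) (p l) x) 0 with h | h
    · rw [Finset.prod_eq_zero (i := l) (Finset.mem_erase.2 ⟨hkl.symm, Finset.mem_univ l⟩)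
        (expNegInvGlue.zero_of_nonpos h), zero_mul]
    · have h' : wave (n s(l, k)) (p l) (p k) x ≤ 0 := by
        rw [Sym2.eq_swap, wave_swap]
        linarith
      rw [Finset.prod_eq_zero (s := Finset.univ.erase l) (i := k) (Finset.mem_erase.2 ⟨hkl, Finset.mem_univ k⟩)
        (expNegInvGlue.zero_of_nonpos h'), mul_zero]
  · exact Finset.prod_nonneg fun l _ => expNegInvGlue.nonneg _
  · exact Finset.prod_pos fun l hl => expNegInvGlue.pos_of_pos
      (wave_pos (hirr k l (Finset.ne_of_mem_erase hl).symm _ (hn0 _)))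

/-! ### Integrals over the unit cube -/

lemma unitCube_eq_pi : unitCube = Set.univ.pi fun _ => Set.Ico (0 : ℝ) 1 := by
  ext x
  simp [unitCube]

lemma integrableOn_unitCube {g : Sp → ℝ} (hg : Continuous g) : IntegrableOn g unitCube := by
  refine (hg.integrableOn_Icc (a := 0) (b := 1)).mono_set fun x hx => ?_
  exact ⟨fun i => (hx i).1, fun i => (hx i).2.le⟩

lemma integral_unitCube_pos {g : Sp → ℝ} (hg : Continuous g) (hper : Per g)
    (h0 : ∀ x, 0 ≤ g x) (hpos : ∃ x, 0 < g x) : 0 < ∫ x in unitCube, g x := by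
  refine lt_of_le_of_ne (integral_nonneg h0) fun h => ?_
  have hae := (setIntegral_eq_zero_iff_of_nonneg_ae (ae_of_all _ h0)
    (integrableOn_unitCube hg)).1 h.symm
  have hcl : unitCube ⊆ closure (interior unitCube) := by
    rw [unitCube_eq_pi, interior_pi_set Set.finite_univ, closure_pi_set]
    refine Set.pi_mono fun i _ => ?_
    rw [interior_Ico, closure_Ioo zero_ne_one]
    exact Set.Ico_subset_Icc_self
  have heq : Set.EqOn g 0 unitCube :=
    Measure.eqOn_of_ae_eq hae hg.continuousOn continuousOn_const hcl
  obtain ⟨x, hx⟩ := hpos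
  have hfr : g (fun i => Int.fract (x i)) = g x := by
    rw [← hper (fun i => Int.fract (x i)) fun i => ⌊x i⌋]
    congr 1
    ext i
    simp
  rw [← hfr, heq fun i => ⟨Int.fract_nonneg _, Int.fract_lt_one _⟩] at hx
  exact lt_irrefl _ hx

lemma exists_mikado_profiles {ι : Type*} [Fintype ι] (f : ι → Fin 3 → ℤ) :
    ∃ χ : ι → Sp → ℝ, (∀ k, ContDiff ℝ (⊤ : ℕ∞) (χ k)) ∧ (∀ k, Per (χ k)) ∧
      (∀ k x (s : ℝ), χ k (x + s • fun i => (f k i : ℝ)) = χ k x) ∧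
      (∀ k l, k ≠ l → ∀ x, χ k x * χ l x = 0) ∧
      (∀ k, ∫ x in unitCube, χ k x = 0) ∧ ∀ k, ∫ x in unitCube, χ k x ^ 2 = 1 := by
  obtain ⟨ψ, hsm, hper, hinv, hdisj, hnn, hpos⟩ := exists_pipes fun k : ι × Bool => f k.1
  set m : ι × Bool → ℝ := fun k => ∫ x in unitCube, ψ k x with hm
  have hm0 : ∀ k, 0 < m k := fun k =>
    integral_unitCube_pos (hsm k).continuous (hper k) (hnn k) (hpos k)
  set φ : ι → Sp → ℝ := fun k x => m (k, false) * ψ (k, true) x - m (k, true) * ψ (k, false) x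
    with hφ
  have hφsm : ∀ k, ContDiff ℝ (⊤ : ℕ∞) (φ k) := fun k =>
    (contDiff_const.mul (hsm _)).sub (contDiff_const.mul (hsm _))
  have hφper : ∀ k, Per (φ k) := fun k x v => by simp only [hφ, hper _ x v]
  set S : ι → ℝ := fun k => ∫ x in unitCube, φ k x ^ 2 with hS
  have hS0 : ∀ k, 0 < S k := by
    intro k
    refine integral_unitCube_pos ((hφsm k).continuous.pow 2)
      (fun x v => by rw [hφper k x v]) (fun x => sq_nonneg _) ?_
    obtain ⟨x, hx⟩ := hpos (k, true)
    have h0 : ψ (k, false) x = 0 := by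
      simpa [hx.ne'] using hdisj (k, true) (k, false) (by simp) x
    refine ⟨x, ?_⟩
    have := mul_pos (hm0 (k, false)) hx
    simp only [hφ, h0, mul_zero, sub_zero]
    positivity
  refine ⟨fun k x => (√(S k))⁻¹ * φ k x, fun k => contDiff_const.mul (hφsm k),
    fun k x v => by simp only [hφper k x v], fun k x s => ?_, fun k l hkl x => ?_, fun k => ?_,
    fun k => ?_⟩
  · have h1 := hinv (k, true) x s
    have h2 := hinv (k, false) x s
    simp only at h1 h2
    simp only [hφ, h1, h2]
  · have h := fun b c => hdisj (k, b) (l, c) (by simp [hkl]) x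
    have h1 := h true true
    have h2 := h true false
    have h3 := h false true
    have h4 := h false false
    have : φ k x * φ l x = 0 := by
      simp only [hφ]
      linear_combination m (k, false) * m (l, false) * h1 - m (k, false) * m (l, true) * h2
        - m (k, true) * m (l, false) * h3 + m (k, true) * m (l, true) * h4
    linear_combination (√(S k))⁻¹ * (√(S l))⁻¹ * this
  · rw [integral_const_mul, integral_sub, integral_const_mul, integral_const_mul]
    · simp only [hm]
      ring
    · exact (integrableOn_unitCube (hsm _).continuous).const_mul _
    · exact (integrableOn_unitCube (hsm _).continuous).const_mul _
  · simp only [mul_pow]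
    rw [integral_const_mul, inv_pow, Real.sq_sqrt (hS0 k).le]
    exact inv_mul_cancel₀ (hS0 k).ne'

/-! ### Positive-definite matrices as positive combinations of integer rank-one matrices -/

lemma tendsto_int_floor_mul_div (a : ℝ) :
    Tendsto (fun N : ℕ => (⌊N * a⌋ : ℝ) / N) atTop (nhds a) := by
  have hlow : Tendsto (fun N : ℕ => a - 1 / (N : ℝ)) atTop (nhds a) := by
    simpa using tendsto_const_nhds.sub (tendsto_one_div_atTop_nhds_zero_nat (𝕜 := ℝ))
  refine tendsto_of_tendsto_of_tendsto_of_le_of_le' hlow tendsto_const_nhds ?_ ?_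
  · filter_upwards [eventually_gt_atTop 0] with N hN
    have hN' : (0 : ℝ) < N := by exact_mod_cast hN
    rw [le_div_iff₀ hN', sub_mul, one_div, inv_mul_cancel₀ hN'.ne']
    linarith [Int.sub_one_lt_floor (N * a)]
  · filter_upwards [eventually_gt_atTop 0] with N hN
    have hN' : (0 : ℝ) < N := by exact_mod_cast hN
    rw [div_le_iff₀ hN']
    linarith [Int.floor_le (N * a)]

open scoped MatrixOrder in
lemma exists_conj_eq_one {R : Mat3} (h : SymPosDef R) :
    ∃ C : Matrix (Fin 3) (Fin 3) ℝ, C.det ≠ 0 ∧ C * Matrix.of R * C.transpose = 1 := by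
  have hpd : (Matrix.of R).PosDef := by
    refine Matrix.posDef_iff_dotProduct_mulVec.2 ⟨?_, fun {x} hx => ?_⟩
    · ext i j
      simp [h.1 i j]
    · simpa [dotProduct, Matrix.mulVec, Finset.mul_sum, mul_assoc] using h.2 x hx
  obtain ⟨B, hB⟩ := CStarAlgebra.nonneg_iff_eq_star_mul_self.mp hpd.posSemidef.nonneg
  have hBt : star B = B.transpose := by
    ext i j
    simp [Matrix.star_apply]
  rw [hBt] at hB
  have hdet : B.det ≠ 0 := by
    intro h0
    have := hpd.det_pos.ne'
    rw [hB, Matrix.det_mul, h0, mul_zero] at this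
    exact this rfl
  have hu : IsUnit B.det := isUnit_iff_ne_zero.2 hdet
  refine ⟨B⁻¹.transpose, ?_, ?_⟩
  · rw [Matrix.det_transpose, Matrix.det_nonsing_inv]
    simpa using hdet
  · rw [hB, Matrix.transpose_transpose, ← Matrix.mul_assoc, ← Matrix.transpose_mul,
      Matrix.mul_nonsing_inv _ hu, Matrix.transpose_one, Matrix.one_mul,
      Matrix.mul_nonsing_inv _ hu]

/-- An integer change of basis brings a positive-definite matrix close to a multiple of the
identity. -/
lemma exists_int_conj_diagDominant {R : Mat3} (h : SymPosDef R) :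
    ∃ (A : Matrix (Fin 3) (Fin 3) ℤ) (τ : ℝ), A.det ≠ 0 ∧
      (∀ i, 2 * τ < (A.map (Int.cast : ℤ → ℝ) * Matrix.of R *
        (A.map (Int.cast : ℤ → ℝ)).transpose) i i) ∧
      ∀ i j, i ≠ j → |(A.map (Int.cast : ℤ → ℝ) * Matrix.of R *
        (A.map (Int.cast : ℤ → ℝ)).transpose) i j| < τ := by
  obtain ⟨C, hdet, hC⟩ := exists_conj_eq_one h
  set Q : Matrix (Fin 3) (Fin 3) ℝ → Matrix (Fin 3) (Fin 3) ℝ :=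
    fun M => M * Matrix.of R * M.transpose with hQ
  have hQc : ∀ i j, Continuous fun M => Q M i j := fun i j =>
    ((continuous_id.matrix_mul continuous_const).matrix_mul
      continuous_id.matrix_transpose).matrix_elem i j
  set A : ℕ → Matrix (Fin 3) (Fin 3) ℤ := fun N => Matrix.of fun i j => ⌊N * C i j⌋ with hA
  set M : ℕ → Matrix (Fin 3) (Fin 3) ℝ :=
    fun N => (N : ℝ)⁻¹ • (A N).map (Int.cast : ℤ → ℝ) with hM
  have hlim : Tendsto M atTop (nhds C) := by
    refine tendsto_pi_nhds.2 fun i => tendsto_pi_nhds.2 fun j => ?_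
    refine (tendsto_int_floor_mul_div (C i j)).congr fun N => ?_
    simp [hM, hA, div_eq_inv_mul]
  have e1 : ∀ᶠ N in atTop, (M N).det ≠ 0 :=
    (((continuous_id.matrix_det (R := ℝ)).tendsto C).comp hlim).eventually_ne hdet
  have e2 : ∀ᶠ N in atTop, ∀ i, 1 / 2 < Q (M N) i i := eventually_all.2 fun i => by
    refine (((hQc i i).tendsto C).comp hlim).eventually_const_lt ?_
    simp only [hQ, hC, Matrix.one_apply_eq]
    norm_num
  have e3 : ∀ᶠ N in atTop, ∀ i j, i ≠ j → |Q (M N) i j| < 1 / 4 :=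
    eventually_all.2 fun i => eventually_all.2 fun j => by
      by_cases hij : i = j
      · simp [hij]
      refine ((((hQc i j).abs.tendsto C).comp hlim).eventually_lt_const ?_).mono
        fun N hN _ => hN
      simp only [hQ, hC, Matrix.one_apply_ne hij]
      norm_num
  obtain ⟨N, hN, h1, h2, h3⟩ := ((eventually_gt_atTop 0).and (e1.and (e2.and e3))).exists
  have hN' : (0 : ℝ) < N := by exact_mod_cast hN
  have hscale : ∀ i j, Q ((A N).map (Int.cast : ℤ → ℝ)) i j = (N : ℝ) ^ 2 * Q (M N) i j := by
    intro i j
    simp only [hQ, hM, Matrix.transpose_smul, Matrix.smul_mul, Matrix.mul_smul,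
      Matrix.smul_apply, smul_eq_mul]
    field_simp
  refine ⟨A N, N ^ 2 / 4, fun h0 => h1 ?_, fun i => ?_, fun i j hij => ?_⟩
  · have : ((A N).map (Int.cast : ℤ → ℝ)).det = (((A N).det : ℤ) : ℝ) :=
      (Int.cast_det (A N)).symm
    rw [hM]
    simp only
    rw [Matrix.det_smul, this, h0]
    simp
  · have := h2 i
    change 2 * ((N : ℝ) ^ 2 / 4) < Q ((A N).map (Int.cast : ℤ → ℝ)) i i
    rw [hscale]
    nlinarith [sq_pos_of_pos hN']
  · have := h3 i j hij
    change |Q ((A N).map (Int.cast : ℤ → ℝ)) i j| < (N : ℝ) ^ 2 / 4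
    rw [hscale, abs_mul, abs_of_pos (by positivity)]
    nlinarith [sq_pos_of_pos hN']

/-- The nine vectors `e_i` and `e_i ± e_j`. -/
def rootVec : Fin 9 → Fin 3 → ℤ :=
  ![![1, 0, 0], ![0, 1, 0], ![0, 0, 1], ![1, 1, 0], ![1, -1, 0], ![1, 0, 1], ![1, 0, -1],
    ![0, 1, 1], ![0, 1, -1]]

/-- The coefficients of a symmetric matrix `Q` along the `v ⊗ v` for `v` in `rootVec`; they are
positive when the diagonal entries of `Q` exceed `2τ` and the others are smaller than `τ`. -/
def rootCoeff (τ : ℝ) (Q : Matrix (Fin 3) (Fin 3) ℝ) : Fin 9 → ℝ :=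
  ![Q 0 0 - 2 * τ, Q 1 1 - 2 * τ, Q 2 2 - 2 * τ, (τ + Q 0 1) / 2, (τ - Q 0 1) / 2,
    (τ + Q 0 2) / 2, (τ - Q 0 2) / 2, (τ + Q 1 2) / 2, (τ - Q 1 2) / 2]

lemma sum_rootCoeff (τ : ℝ) {Q : Matrix (Fin 3) (Fin 3) ℝ} (hQ : ∀ i j, Q i j = Q j i)
    (i j : Fin 3) : ∑ k, rootCoeff τ Q k * (rootVec k i * rootVec k j : ℤ) = Q i j := by
  have h1 := hQ 1 0
  have h2 := hQ 2 0
  have h3 := hQ 2 1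
  fin_cases i <;> fin_cases j <;>
    simp [Fin.sum_univ_succ, rootCoeff, rootVec, h1, h2, h3] <;> ring

lemma rootCoeff_pos {τ : ℝ} {Q : Matrix (Fin 3) (Fin 3) ℝ} (hd : ∀ i, 2 * τ < Q i i)
    (ho : ∀ i j, i ≠ j → |Q i j| < τ) (k : Fin 9) : 0 < rootCoeff τ Q k := by
  have h1 := abs_lt.1 (ho 0 1 (by decide))
  have h2 := abs_lt.1 (ho 0 2 (by decide))
  have h3 := abs_lt.1 (ho 1 2 (by decide))
  have d0 := hd 0
  have d1 := hd 1
  have d2 := hd 2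
  fin_cases k <;> simp [rootCoeff] <;> linarith

lemma exists_local_decomposition {R₀ : Mat3} (h : SymPosDef R₀) :
    ∃ (f : Fin 9 → Fin 3 → ℤ) (c : Fin 9 → Mat3 → ℝ),
      (∀ k, ContDiff ℝ (⊤ : ℕ∞) (c k)) ∧ (∀ k, 0 < c k R₀) ∧
      ∀ R : Mat3, (∀ i j, R i j = R j i) →
        ∀ i j, ∑ k, c k R * ((f k i : ℝ) * f k j) = R i j := by
  obtain ⟨A, τ, hdet, hd, ho⟩ := exists_int_conj_diagDominant h
  set B : Matrix (Fin 3) (Fin 3) ℝ := A.map (Int.cast : ℤ → ℝ) with hB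
  have hBdet : B.det = (A.det : ℝ) := (Int.cast_det A).symm
  have hBdet0 : B.det ≠ 0 := by
    rw [hBdet]
    exact_mod_cast hdet
  have hadj : B.adjugate = A.adjugate.map (Int.cast : ℤ → ℝ) :=
    ((Int.castRingHom ℝ).map_adjugate A).symm
  set Q : Mat3 → Matrix (Fin 3) (Fin 3) ℝ := fun R => B * Matrix.of R * B.transpose with hQ
  refine ⟨fun k i => ∑ p, A.adjugate i p * rootVec k p,
    fun k R => rootCoeff τ (Q R) k / B.det ^ 2, fun k => ?_, fun k => ?_, fun R hR i j => ?_⟩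
  · have hent : ∀ i j, ContDiff ℝ (⊤ : ℕ∞) fun R : Mat3 => Q R i j := by
      intro i j
      simp only [hQ, Matrix.mul_apply, Matrix.of_apply, Matrix.transpose_apply]
      fun_prop
    refine ContDiff.div_const ?_ _
    fin_cases k <;> simp [rootCoeff] <;> fun_prop
  · have := rootCoeff_pos (Q := Q R₀) hd ho k
    positivity
  · have hsymm : ∀ p q, Q R p q = Q R q p := by
      have hRt : (Matrix.of R).transpose = Matrix.of R := by
        ext p q
        simp [hR p q]
      intro p q
      have : (Q R).transpose = Q R := by
        simp only [hQ, Matrix.transpose_mul, Matrix.transpose_transpose, hRt, Matrix.mul_assoc]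
      rw [← this, Matrix.transpose_apply, this]
    have hconj : B.adjugate * Q R * B.adjugate.transpose = B.det ^ 2 • Matrix.of R := by
      have h1 : B.adjugate * Q R * B.adjugate.transpose =
          (B.adjugate * B) * Matrix.of R * (B.adjugate * B).transpose := by
        simp only [hQ, Matrix.transpose_mul, Matrix.mul_assoc]
      rw [h1, Matrix.adjugate_mul]
      simp [smul_smul, sq]
    have hij := congrFun (congrFun hconj i) j
    simp only [Matrix.mul_apply, Matrix.transpose_apply, Matrix.smul_apply, Matrix.of_apply,
      smul_eq_mul] at hij
    rw [← mul_right_inj' (pow_ne_zero 2 hBdet0), ← hij]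
    simp only [← sum_rootCoeff τ hsymm, hadj, Matrix.map_apply]
    push_cast
    simp only [Fin.sum_univ_three, Finset.mul_sum, Finset.sum_mul, ← Finset.sum_add_distrib]
    refine Finset.sum_congr rfl fun k _ => ?_
    field_simp

/-- Multiplied by a bump function, the square roots of the coefficients of the decomposition near
`R₀` become globally smooth. -/
lemma exists_localized_decomposition {R₀ : Mat3} (h : SymPosDef R₀) :
    ∃ (f : Fin 9 → Fin 3 → ℤ) (b : Fin 9 → Mat3 → ℝ) (β : Mat3 → ℝ),
      (∀ k, ContDiff ℝ (⊤ : ℕ∞) (b k)) ∧ ContDiff ℝ (⊤ : ℕ∞) β ∧ (∀ R, 0 ≤ β R) ∧ 0 < β R₀ ∧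
      ∀ R : Mat3, (∀ i j, R i j = R j i) →
        ∀ i j, ∑ k, b k R ^ 2 * ((f k i : ℝ) * f k j) = β R * R i j := by
  obtain ⟨f, c, hc, hpos, hsum⟩ := exists_local_decomposition h
  have hev : ∀ᶠ R in nhds R₀, ∀ k, 0 < c k R := eventually_all.2 fun k =>
    (hc k).continuous.continuousAt.eventually_const_lt (hpos k)
  obtain ⟨ε, hε, hball⟩ := Metric.eventually_nhds_iff_ball.1 hev
  let η : ContDiffBump R₀ := ⟨ε / 3, ε / 2, by positivity, by linarith⟩
  have hηc : ∀ R k, η R ≠ 0 → 0 < c k R := by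
    intro R k hR
    have hmem : R ∈ Function.support η := hR
    rw [η.support_eq] at hmem
    exact hball R (Metric.ball_subset_ball (by change ε / 2 ≤ ε; linarith) hmem) k
  refine ⟨f, fun k R => η R * √(c k R), fun R => η R ^ 2, fun k => ?_, η.contDiff.pow 2,
    fun R => sq_nonneg _, ?_, fun R hR i j => ?_⟩
  · refine contDiff_iff_contDiffAt.2 fun R => ?_
    by_cases hR : R ∈ Metric.ball R₀ ε
    · exact η.contDiffAt.mul ((hc k).contDiffAt.sqrt (hball R hR k).ne')
    · have hnot : R ∉ tsupport η := by
        rw [η.tsupport_eq]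
        refine fun hmem => hR (Metric.closedBall_subset_ball ?_ hmem)
        change ε / 2 < ε
        linarith
      refine (contDiffAt_const (c := (0 : ℝ))).congr_of_eventuallyEq ?_
      filter_upwards [notMem_tsupport_iff_eventuallyEq.1 hnot] with R' hR'
      simp [hR']
  · have := η.pos_of_mem_ball (Metric.mem_ball_self η.rOut_pos)
    positivity
  · rw [← hsum R hR i j, Finset.mul_sum]
    refine Finset.sum_congr rfl fun k _ => ?_
    by_cases hR0 : η R = 0
    · simp [hR0]
    · rw [mul_pow, Real.sq_sqrt (hηc R k hR0).le, mul_assoc]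

lemma exists_decomposition {𝒩 : Set Mat3} (hcpt : IsCompact 𝒩) (hpos : ∀ R ∈ 𝒩, SymPosDef R) :
    ∃ (ι : Type) (_ : Fintype ι) (f : ι → Fin 3 → ℤ) (a : ι → Mat3 → ℝ),
      (∀ k, ContDiffOn ℝ (⊤ : ℕ∞) (a k) 𝒩) ∧
      ∀ R ∈ 𝒩, ∀ i j, ∑ k, a k R ^ 2 * ((f k i : ℝ) * f k j) = R i j := by
  choose f b β hb hβ hβ0 hβpos hsum using fun R : 𝒩 => exists_localized_decomposition (hpos R R.2)
  obtain ⟨t, ht⟩ := hcpt.elim_nhds_subcover' (fun R hR => {R' | 0 < β ⟨R, hR⟩ R'})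
    fun R hR => (hβ ⟨R, hR⟩).continuous.continuousAt.eventually_const_lt (hβpos ⟨R, hR⟩)
  set S : Mat3 → ℝ := fun R => ∑ m : t, β m R with hS
  have hSsm : ContDiff ℝ (⊤ : ℕ∞) S := ContDiff.sum fun m _ => hβ m
  have hS0 : ∀ R ∈ 𝒩, 0 < S R := by
    intro R hR
    obtain ⟨m, hm, hmR⟩ := Set.mem_iUnion₂.1 (ht hR)
    exact Finset.sum_pos' (fun m _ => hβ0 m R) ⟨⟨m, hm⟩, Finset.mem_univ _, hmR⟩
  refine ⟨t × Fin 9, inferInstance, fun k => f k.1 k.2, fun k R => b k.1 k.2 R / √(S R),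
    fun k => ?_, fun R hR i j => ?_⟩
  · exact (hb _ _).contDiffOn.div (hSsm.contDiffOn.sqrt fun R hR => (hS0 R hR).ne')
      fun R hR => (Real.sqrt_pos.2 (hS0 R hR)).ne'
  · have hinner : ∀ m : t, ∑ k, (b m k R / √(S R)) ^ 2 * ((f m k i : ℝ) * f m k j) =
        β m R * (R i j / S R) := by
      intro m
      have h := hsum m R (hpos R hR).1 i j
      calc _ = (∑ k, b m k R ^ 2 * ((f m k i : ℝ) * f m k j)) / S R := by
            rw [Finset.sum_div]
            refine Finset.sum_congr rfl fun k _ => ?_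
            rw [div_pow, Real.sq_sqrt (hS0 R hR).le]
            ring
        _ = _ := by rw [h, mul_div_assoc]
    rw [Fintype.sum_prod_type]
    simp only [hinner]
    rw [← Finset.sum_mul]
    exact mul_div_cancel₀ _ (hS0 R hR).ne'

/-! ### The flow -/

/-- A combination of fields `Φ k • f k`, each `Φ k` being invariant along `f k`, is
divergence-free. -/
lemma sum_pd_eq_zero {ι : Type*} [Fintype ι] (f : ι → Fin 3 → ℤ) (Φ : ι → Sp → ℝ)
    (hΦ : ∀ k, Differentiable ℝ (Φ k))
    (hinv : ∀ k x (s : ℝ), Φ k (x + s • fun i => (f k i : ℝ)) = Φ k x) (c : ι → ℝ) (x : Sp) :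
    ∑ j, pd j (fun y => ∑ k, c k * Φ k y * f k j) x = 0 := by
  have hdir : ∀ k, fderiv ℝ (Φ k) x (fun i => (f k i : ℝ)) = 0 := by
    intro k
    rw [← (hΦ k x).lineDeriv_eq_fderiv]
    simp [lineDeriv, hinv]
  have hpd : ∀ j, pd j (fun y => ∑ k, c k * Φ k y * f k j) x =
      ∑ k, c k * (f k j * fderiv ℝ (Φ k) x (Pi.single j 1)) := by
    intro j
    have hder : HasFDerivAt (fun y => ∑ k, c k * Φ k y * f k j)
        (∑ k, (f k j : ℝ) • (c k • fderiv ℝ (Φ k) x)) x :=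
      HasFDerivAt.fun_sum fun k _ =>
        (((hΦ k x).hasFDerivAt.const_mul (c k)).mul_const (f k j : ℝ))
    rw [pd, hder.fderiv, sum_apply]
    refine Finset.sum_congr rfl fun k _ => ?_
    simp only [smul_apply, smul_eq_mul]
    ring
  simp only [hpd]
  rw [Finset.sum_comm]
  refine Finset.sum_eq_zero fun k _ => ?_
  rw [← Finset.mul_sum, ← mul_zero (c k), ← hdir k]
  congr 1
  conv_rhs => rw [pi_eq_sum_univ' (fun i => (f k i : ℝ)), map_sum]
  refine Finset.sum_congr rfl fun j _ => ?_
  rw [map_smul, smul_eq_mul]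

lemma sum_mul_sum_of_disjoint {ι : Type*} [Fintype ι] {u v : ι → ℝ}
    (h : ∀ k l, k ≠ l → u k * v l = 0) : (∑ k, u k) * ∑ l, v l = ∑ k, u k * v k := by
  rw [Finset.sum_mul_sum]
  exact Finset.sum_congr rfl fun k _ =>
    Finset.sum_eq_single k (fun l _ hl => h k l hl.symm) (by simp)

/-- Existence of Mikado flows: for every compact set
`𝒩 ⊂⊂ 𝒮^{3×3}_+` there is a smooth vector field `W : 𝒩 × 𝕋³ → ℝ³` which for every
`R ∈ 𝒩` is divergence-free, has divergence-free self-tensor-product, zero average, and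
`⨍ W ⊗ W = R` (the cube has unit volume, so averages are integrals over `unitCube`). -/
theorem mikado_flows (𝒩 : Set Mat3) (hcpt : IsCompact 𝒩) (hpos : ∀ R ∈ 𝒩, SymPosDef R) :
    ∃ W : Mat3 → Sp → V3,
      ContDiffOn ℝ (⊤ : ℕ∞) (fun p : Mat3 × Sp => W p.1 p.2) (𝒩 ×ˢ Set.univ) ∧
      (∀ R ∈ 𝒩, Per (W R)) ∧
      (∀ R ∈ 𝒩, ∀ ξ : Sp, sdiv (W R) ξ = 0) ∧
      (∀ R ∈ 𝒩, ∀ ξ : Sp, ∀ i, (∑ j, pd j (fun y => W R y i * W R y j) ξ) = 0) ∧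
      (∀ R ∈ 𝒩, ∀ i, (∫ ξ in unitCube, W R ξ i) = 0) ∧
      (∀ R ∈ 𝒩, ∀ i j, (∫ ξ in unitCube, W R ξ i * W R ξ j) = R i j) := by

  obtain ⟨ι, _, f, a, ha, hsum⟩ := exists_decomposition hcpt hpos
  obtain ⟨χ, hsm, hper, hinv, hdisj, hmean, hsq⟩ := exists_mikado_profiles f
  have hcross : ∀ R x i j, (∑ k, a k R * χ k x * f k i) * (∑ k, a k R * χ k x * f k j) =
      ∑ k, (a k R ^ 2 * f k i) * χ k x ^ 2 * f k j := by
    intro R x i j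
    rw [sum_mul_sum_of_disjoint fun k l hkl => by
      linear_combination (a k R * f k i * a l R * f l j) * hdisj k l hkl x]
    exact Finset.sum_congr rfl fun k _ => by ring
  refine ⟨fun R x i => ∑ k, a k R * χ k x * f k i, ?_, fun R _ x v => ?_, fun R _ x => ?_,
    fun R _ x i => ?_, fun R _ i => ?_, fun R hR i j => ?_⟩
  · refine contDiffOn_pi.2 fun i => ContDiffOn.sum fun k _ => ?_
    refine ContDiffOn.mul (ContDiffOn.mul ?_ ?_) contDiffOn_const
    · exact (ha k).comp contDiff_fst.contDiffOn fun p hp => hp.1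
    · exact ((hsm k).comp contDiff_snd).contDiffOn
  · simp only [hper _ x v]
  · exact sum_pd_eq_zero f χ (fun k => (hsm k).differentiable (by simp)) hinv _ x
  · simp only [hcross]
    refine sum_pd_eq_zero f (fun k y => χ k y ^ 2)
      (fun k => ((hsm k).differentiable (by simp)).pow 2) (fun k y s => ?_) _ x
    simp only [hinv k y s]
  · rw [integral_finsetSum _ fun k _ =>
      ((integrableOn_unitCube (hsm k).continuous).const_mul _).mul_const _]
    simp [integral_mul_const, integral_const_mul, hmean]
  · simp only [hcross]
    have hint : ∀ k, IntegrableOn (fun ξ => χ k ξ ^ 2) unitCube := fun k =>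
      integrableOn_unitCube ((hsm k).continuous.pow 2)
    rw [integral_finsetSum _ fun k _ => ((hint k).const_mul _).mul_const _, ← hsum R hR i j]
    simp [integral_mul_const, integral_const_mul, hsq, mul_assoc]

end FNS
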